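/- Let k be a field of characteristic zero with algebraic closure k̄, A a finitely generated commutative k-algebra, G a finite group acting on A by k-algebra automorphisms, and M a finitely generated G-equivariant A-module. Suppose that for every maximal ideal n of A, both M ⊗_A A/n and Tor_1^A(M, A/n) are generated as A/n-modules by G_n-fixed elements. Let A_k̄ = A ⊗_k k̄ with G acting through the factor A, and M_k̄ = M ⊗_k k̄. Then for every maximal ideal x of A_k̄, the stabilizer G_x = {g ∈ G : g•x = x} fixes every element of M_k̄ ⊗_{A_k̄} A_k̄/x and of Tor_1^{A_k̄}(M_k̄, A_k̄/x). -/

import Mathlib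

/-!
STATEMENT 12: let `k` be a field of characteristic zero with algebraic
closure `K`, `A` a finitely generated commutative `k`-algebra, `G` a finite
group acting on `A` by `k`-algebra automorphisms, and `M` a finitely
generated `G`-equivariant `A`-module.  Suppose that for every maximal ideal
`n` of `A` both `M ⊗[A] A/n` and `Tor₁ᴬ(M, A/n)` are generated by
`G_n`-fixed elements.  Then for every maximal ideal `x` of `A_K := A ⊗[k] K`
(with `G` acting through the factor `A`), the stabilizer `G_x` fixes every
element of `M_K ⊗[A_K] A_K/x` and of `Tor₁^{A_K}(M_K, A_K/x)`, where
`M_K = M ⊗[k] K`, realized as the base change `(A ⊗[k] K) ⊗[A] M` (canonically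
isomorphic to `M ⊗[k] K` as an `A ⊗[k] K`-module).

Conventions (as in the other files):
* fibers at a maximal ideal `m` are realized as quotients by `m • ⊤`, so that
  "`g` fixes the class of `y`" reads `g • y - y ∈ m • ⊤`;
* `Tor₁` at `m` is realized as the kernel of the multiplication map
  `m ⊗ M → M`, with the stabilizer acting via `torSmul`.
-/

open TensorProduct

universe u v w

/-- The multiplication map `m ⊗[A] M →ₗ[A] M`.  Its kernel is the standard
model for `Tor₁ᴬ(M, A/m)` (tensor the exact sequence `0 → m → A → A/m → 0`
with `M` and use `Tor₁ᴬ(M, A) = 0`). -/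
noncomputable def torMul (A : Type u) [CommRing A] (M : Type v) [AddCommGroup M]
    [Module A M] (m : Ideal A) : (m ⊗[A] M) →ₗ[A] M :=
  TensorProduct.lift ((LinearMap.lsmul A M).comp m.subtype)

/-- The additive (semilinear) endomorphism of `m ⊗[A] M` induced by a ring
endomorphism `σ` of `A` preserving `m` together with a `σ`-semilinear additive
endomorphism `τ` of `M`; for `σ`, `τ` given by the action of a stabilizer
element `g ∈ G_m` this is the action of `g` on `m ⊗[A] M`, i.e. on
`Tor₁ᴬ(M, A/m)` by functoriality. -/
noncomputable def torSmul {A : Type u} [CommRing A] {M : Type v} [AddCommGroup M]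
    [Module A M] (σ : A →+* A) (τ : M →+ M)
    (hτ : ∀ (a : A) (x : M), τ (a • x) = σ a • τ x)
    (m : Ideal A) (hm : ∀ a ∈ m, σ a ∈ m) :
    (m ⊗[A] M) →+ (m ⊗[A] M) :=
  TensorProduct.liftAddHom
    { toFun := fun x =>
        { toFun := fun y => (⟨σ (x : A), hm _ x.2⟩ : m) ⊗ₜ[A] (τ y)
          map_zero' := by simp
          map_add' := fun y z => by simp [TensorProduct.tmul_add] }
      map_zero' := by
        have h : (⟨σ ((0 : m) : A), hm _ (0 : m).2⟩ : m) = 0 := Subtype.ext (by simp)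
        ext y
        simp only [AddMonoidHom.coe_mk, ZeroHom.coe_mk, AddMonoidHom.zero_apply, h,
          TensorProduct.zero_tmul]
      map_add' := fun x x' => by
        have h : (⟨σ ((x + x' : m) : A), hm _ (x + x').2⟩ : m)
            = ⟨σ (x : A), hm _ x.2⟩ + ⟨σ (x' : A), hm _ x'.2⟩ := Subtype.ext (by simp)
        ext y
        simp only [AddMonoidHom.coe_mk, ZeroHom.coe_mk, AddMonoidHom.add_apply, h,
          TensorProduct.add_tmul] }
    (fun a x y => by
      have h1 : (⟨σ ((a • x : m) : A), hm _ (a • x).2⟩ : m)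
          = σ a • (⟨σ (x : A), hm _ x.2⟩ : m) :=
        Subtype.ext (by simp [smul_eq_mul, map_mul])
      simp only [AddMonoidHom.coe_mk, ZeroHom.coe_mk]
      rw [h1, TensorProduct.smul_tmul, hτ])

section BaseChange

variable (k : Type*) [Field k] (K : Type*) [Field K] [Algebra k K]
variable (A : Type u) [CommRing A] [Algebra k A]
variable (G : Type w) [Group G] [MulSemiringAction G A] [SMulCommClass G k A]

/-- The `G`-action on `A ⊗[k] K` through the factor `A`. -/
noncomputable instance baseChangeAction : MulSemiringAction G (A ⊗[k] K) where
  smul g := Algebra.TensorProduct.map (MulSemiringAction.toAlgHom k A g) (AlgHom.id k K)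
  one_smul t := by
    show Algebra.TensorProduct.map (MulSemiringAction.toAlgHom k A 1) (AlgHom.id k K) t = t
    induction t with
    | zero => simp
    | tmul a c => simp
    | add x y hx hy => rw [map_add, hx, hy]
  mul_smul g h t := by
    show Algebra.TensorProduct.map (MulSemiringAction.toAlgHom k A (g * h)) (AlgHom.id k K) t
      = Algebra.TensorProduct.map (MulSemiringAction.toAlgHom k A g) (AlgHom.id k K)
        (Algebra.TensorProduct.map (MulSemiringAction.toAlgHom k A h) (AlgHom.id k K) t)
    induction t with
    | zero => simp
    | tmul a c => simp [mul_smul]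
    | add x y hx hy => rw [map_add, map_add, map_add, hx, hy]
  smul_zero g := map_zero _
  smul_add g := map_add _
  smul_one g := map_one _
  smul_mul g := map_mul _

@[simp] theorem baseChange_smul_tmul (g : G) (a : A) (c : K) :
    g • (a ⊗ₜ[k] c : A ⊗[k] K) = (g • a) ⊗ₜ[k] c := by
  show Algebra.TensorProduct.map (MulSemiringAction.toAlgHom k A g) (AlgHom.id k K) (a ⊗ₜ[k] c)
    = (g • a) ⊗ₜ[k] c
  simp

theorem baseChange_smul_algebraMap (g : G) (a : A) :
    g • (algebraMap A (A ⊗[k] K) a) = algebraMap A (A ⊗[k] K) (g • a) := by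
  rw [Algebra.TensorProduct.algebraMap_apply, Algebra.TensorProduct.algebraMap_apply,
    baseChange_smul_tmul]
  simp

variable (M : Type v) [AddCommGroup M] [Module A M] [DistribMulAction G M]

/-- The action of `g : G` on `M ⊗_k K`, realized as `(A ⊗[k] K) ⊗[A] M`:
`g • (b ⊗ x) = (g • b) ⊗ (g • x)`. -/
noncomputable def bcModSmul
    (hGM : ∀ (g : G) (a : A) (x : M), g • (a • x) = (g • a) • (g • x)) (g : G) :
    ((A ⊗[k] K) ⊗[A] M) →+ ((A ⊗[k] K) ⊗[A] M) :=
  TensorProduct.liftAddHom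
    { toFun := fun b =>
        { toFun := fun x => (g • b) ⊗ₜ[A] (g • x)
          map_zero' := by simp
          map_add' := fun x y => by simp [TensorProduct.tmul_add] }
      map_zero' := by ext x; simp
      map_add' := fun b b' => by ext x; simp [TensorProduct.add_tmul] }
    (fun a b x => by
      simp only [AddMonoidHom.coe_mk, ZeroHom.coe_mk]
      rw [show g • (a • b) = (g • a) • (g • b) from by
            rw [Algebra.smul_def, smul_mul', baseChange_smul_algebraMap, ← Algebra.smul_def],
        TensorProduct.smul_tmul, hGM]) 

end BaseChange

section More

variable (k : Type*) [Field k] (K : Type*) [Field K] [Algebra k K]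
variable (A : Type u) [CommRing A] [Algebra k A]
variable (G : Type w) [Group G] [MulSemiringAction G A] [SMulCommClass G k A]
variable (M : Type v) [AddCommGroup M] [Module A M] [DistribMulAction G M]
variable (hGM : ∀ (g : G) (a : A) (x : M), g • (a • x) = (g • a) • (g • x))

@[simp] theorem bcModSmul_tmul (g : G) (b : A ⊗[k] K) (x : M) :
    bcModSmul k K A G M hGM g (b ⊗ₜ[A] x) = (g • b) ⊗ₜ[A] (g • x) :=
  TensorProduct.liftAddHom_tmul _ _ _ _

/-- `g`-semilinearity of the `G`-action on `(A ⊗[k] K) ⊗[A] M` over the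
`G`-action on `A ⊗[k] K`. -/
theorem bcModSmul_smul (g : G) (b : A ⊗[k] K) (t : (A ⊗[k] K) ⊗[A] M) :
    bcModSmul k K A G M hGM g (b • t) = (g • b) • bcModSmul k K A G M hGM g t := by
  induction t with
  | zero => simp
  | tmul b' x =>
      rw [TensorProduct.smul_tmul', bcModSmul_tmul, bcModSmul_tmul,
        TensorProduct.smul_tmul', smul_eq_mul, smul_eq_mul, smul_mul']
  | add s t hs ht => rw [smul_add, map_add, hs, ht, map_add, smul_add]

end More

section Helpers

theorem torMul_tmul' (A : Type u) [CommRing A] (M : Type v) [AddCommGroup M]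
    [Module A M] (m : Ideal A) (a : m) (y : M) : torMul A M m (a ⊗ₜ y) = (a : A) • y := by
  simp [torMul]

theorem torSmul_tmul' {A : Type u} [CommRing A] {M : Type v} [AddCommGroup M]
    [Module A M] (σ : A →+* A) (τ : M →+ M)
    (hτ : ∀ (a : A) (x : M), τ (a • x) = σ a • τ x)
    (m : Ideal A) (hm : ∀ a ∈ m, σ a ∈ m) (a : m) (y : M) :
    torSmul σ τ hτ m hm (a ⊗ₜ y) = (⟨σ (a : A), hm _ a.2⟩ : m) ⊗ₜ[A] (τ y) :=
  TensorProduct.liftAddHom_tmul _ _ _ _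

theorem torSmul_smul' {A : Type u} [CommRing A] {M : Type v} [AddCommGroup M]
    [Module A M] (σ : A →+* A) (τ : M →+ M)
    (hτ : ∀ (a : A) (x : M), τ (a • x) = σ a • τ x)
    (m : Ideal A) (hm : ∀ a ∈ m, σ a ∈ m) (a : A) (t : m ⊗[A] M) :
    torSmul σ τ hτ m hm (a • t) = σ a • torSmul σ τ hτ m hm t := by
  induction t with
  | zero => simp
  | tmul b y =>
    rw [← TensorProduct.tmul_smul, torSmul_tmul', torSmul_tmul', hτ, TensorProduct.tmul_smul]
  | add s t hs ht => rw [smul_add, map_add, hs, ht, map_add, smul_add]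

/-- `m` kills the kernel of `m ⊗ M → M`. -/
theorem smul_eq_zero_of_torMul {A : Type u} [CommRing A] {M : Type v} [AddCommGroup M]
    [Module A M] (m : Ideal A) (a : A) (ha : a ∈ m) (t : m ⊗[A] M)
    (ht : torMul A M m t = 0) : a • t = 0 := by
  have key : ∀ t : m ⊗[A] M, a • t = (⟨a, ha⟩ : m) ⊗ₜ[A] torMul A M m t := by
    intro t
    induction t with
    | zero => simp
    | tmul b y =>
      rw [torMul_tmul', TensorProduct.tmul_smul, TensorProduct.smul_tmul',
        TensorProduct.smul_tmul']
      congr 1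
      ext
      simp [mul_comm]
    | add s t hs ht => rw [smul_add, map_add, hs, ht, TensorProduct.tmul_add]
  rw [key, ht, TensorProduct.tmul_zero]

theorem smul_eq_smul_of_torMul {A : Type u} [CommRing A] {M : Type v} [AddCommGroup M]
    [Module A M] (m : Ideal A) (a b : A) (ha : a - b ∈ m) (t : m ⊗[A] M)
    (ht : torMul A M m t = 0) : a • t = b • t := by
  have h := smul_eq_zero_of_torMul m (a - b) ha t ht
  have e : a • t = (a - b) • t + b • t := by rw [← add_smul, sub_add_cancel]
  rw [e, h, zero_add]

variable (k : Type*) [Field k] (K : Type*) [Field K] [Algebra k K]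
variable (A : Type u) [CommRing A] [Algebra k A]

theorem exists_scalar_mod [IsAlgClosed K] [Algebra.IsAlgebraic k K]
    (x : Ideal (A ⊗[k] K)) [x.IsMaximal]
    (hA : ∀ a : A, ∃ p : Polynomial k, p.Monic ∧
      Polynomial.aeval a p ∈ x.comap (algebraMap A (A ⊗[k] K)))
    (b : A ⊗[k] K) : ∃ c : K, b - 1 ⊗ₜ c ∈ x := by
  induction b with
  | zero => exact ⟨0, by simp⟩
  | add b b' h h' =>
    obtain ⟨c, hc⟩ := h
    obtain ⟨c', hc'⟩ := h'
    refine ⟨c + c', ?_⟩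
    rw [TensorProduct.tmul_add, add_sub_add_comm]
    exact add_mem hc hc'
  | tmul a c =>
    obtain ⟨p, hp, hpa⟩ := hA a
    letI : Field ((A ⊗[k] K) ⧸ x) := Ideal.Quotient.field x
    let ι : K →+* (A ⊗[k] K) ⧸ x := (Ideal.Quotient.mk x).comp
      (Algebra.TensorProduct.includeRight : K →ₐ[k] A ⊗[k] K).toRingHom
    have hroot : (p.map (algebraMap k K)).eval₂ ι (Ideal.Quotient.mk x (a ⊗ₜ 1)) = 0 := by
      rw [Polynomial.eval₂_map]
      rw [Ideal.mem_comap, ← Ideal.Quotient.eq_zero_iff_mem] at hpa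
      rw [← hpa, Polynomial.aeval_def, Polynomial.hom_eval₂, Polynomial.hom_eval₂]
      congr 1
      ext r
      simp only [ι, RingHom.comp_apply]
      congr 1
      simp [Algebra.algebraMap_eq_smul_one, Algebra.TensorProduct.one_def]
    have hs : (p.map (algebraMap k K)).Splits := IsAlgClosed.splits _
    obtain ⟨d, hd⟩ : ∃ d : K, ι d = Ideal.Quotient.mk x (a ⊗ₜ 1) := by
      have hm : (p.map (algebraMap k K)).Monic := hp.map _
      rw [hs.eq_prod_roots_of_monic hm, Polynomial.eval₂_multiset_prod, Multiset.prod_eq_zero_iff] at hroot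
      simp only [Multiset.mem_map] at hroot
      obtain ⟨_, ⟨d, -, rfl⟩, h⟩ := hroot
      refine ⟨d, ?_⟩
      rw [Polynomial.eval₂_sub, Polynomial.eval₂_X, Polynomial.eval₂_C, sub_eq_zero] at h
      exact h.symm
    refine ⟨d * c, ?_⟩
    have h1 : a ⊗ₜ[k] (1:K) - 1 ⊗ₜ d ∈ x := by
      rw [← Ideal.Quotient.mk_eq_mk_iff_sub_mem, ← hd]; rfl
    have := x.mul_mem_right ((1:A) ⊗ₜ[k] c) h1
    simpa [sub_mul] using this

/-- Separability: locally at `x`, the ideal `x` is generated by `n = x ∩ A`. -/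
theorem exists_local_generator [CharZero k] 
    (x : Ideal (A ⊗[k] K)) [x.IsMaximal] (n : Ideal A) [n.IsMaximal]
    (hn : n = x.comap (algebraMap A (A ⊗[k] K))) [Module.Finite k (A ⧸ n)]
    (hx : ∀ b : A ⊗[k] K, ∃ c : K, b - 1 ⊗ₜ c ∈ x) :
    ∃ s : A ⊗[k] K, s ∉ x ∧ ∀ b ∈ x, s * b ∈ n.map (algebraMap A (A ⊗[k] K)) := by
  letI : Field (A ⧸ n) := Ideal.Quotient.field n
  obtain ⟨α, hα⟩ := Field.exists_primitive_element k (A ⧸ n)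
  have hαi : IsIntegral k α := Algebra.IsIntegral.isIntegral α
  obtain ⟨a, rfl⟩ := Ideal.Quotient.mk_surjective α
  obtain ⟨c, hc⟩ := hx (a ⊗ₜ 1)
  let ρ : K →+* A ⊗[k] K := (Algebra.TensorProduct.includeRight : K →ₐ[k] A ⊗[k] K).toRingHom
  have hρ : ∀ d, ρ d = 1 ⊗ₜ d := fun _ => rfl
  let ev : Polynomial K →+* A ⊗[k] K := Polynomial.eval₂RingHom ρ (a ⊗ₜ 1)
  let N := n.map (algebraMap A (A ⊗[k] K))
  have hNx : N ≤ x := by rw [Ideal.map_le_iff_le_comap, hn]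
  have hevmap : ∀ q : Polynomial k,
      ev (q.map (algebraMap k K)) = algebraMap A (A ⊗[k] K) (Polynomial.aeval a q) := by
    intro q
    simp only [ev, Polynomial.coe_eval₂RingHom]
    rw [Polynomial.eval₂_map, Polynomial.aeval_def, Polynomial.hom_eval₂]
    congr 1
    ext r
    simp [hρ, Algebra.algebraMap_eq_smul_one, Algebra.TensorProduct.one_def]
  have claim1 : ∀ b : A ⊗[k] K, ∃ f : Polynomial K, b - ev f ∈ N := by
    intro b
    induction b with
    | zero => exact ⟨0, by simp⟩
    | add b b' h h' =>
      obtain ⟨f, hf⟩ := h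
      obtain ⟨f', hf'⟩ := h'
      refine ⟨f + f', ?_⟩
      rw [map_add, add_sub_add_comm]
      exact add_mem hf hf'
    | tmul a' d =>
      have h1 : Ideal.Quotient.mk n a' ∈ Algebra.adjoin k {Ideal.Quotient.mk n a} := by
        rw [← IntermediateField.adjoin_simple_toSubalgebra_of_isAlgebraic hαi.isAlgebraic, hα]
        trivial
      rw [Algebra.adjoin_singleton_eq_range_aeval] at h1
      obtain ⟨q, hq⟩ := h1
      have h2 : a' - Polynomial.aeval a q ∈ n := by
        rw [← Ideal.Quotient.mk_eq_mk_iff_sub_mem, ← hq]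
        exact Polynomial.aeval_algHom_apply (Ideal.Quotient.mkₐ k n) a q
      refine ⟨q.map (algebraMap k K) * Polynomial.C d, ?_⟩
      rw [map_mul, hevmap]
      have h3 : ev (Polynomial.C d) = 1 ⊗ₜ d := by simp [ev, hρ]
      have h4 : a' ⊗ₜ[k] d = algebraMap A (A ⊗[k] K) a' * (1 ⊗ₜ d) := by simp
      rw [h3, h4, ← sub_mul, ← map_sub]
      exact N.mul_mem_right _ (Ideal.mem_map_of_mem _ h2)
  have hdvd : ∀ f : Polynomial K, ev f - ρ (f.eval c) ∈ x := by
    intro f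
    obtain ⟨q, hq⟩ := Polynomial.X_sub_C_dvd_sub_C_eval (p := f) (a := c)
    have h1 := congrArg ev hq
    have h2 : ev (Polynomial.C (f.eval c)) = ρ (f.eval c) := by simp [ev]
    have h3 : ev (Polynomial.X - Polynomial.C c) = a ⊗ₜ 1 - 1 ⊗ₜ c := by simp [ev, hρ]
    rw [map_sub, map_mul, h2, h3] at h1
    rw [h1]
    exact x.mul_mem_right _ hc
  have heval : ∀ f : Polynomial K, ev f ∈ x → f.eval c = 0 := by
    intro f hf
    by_contra h0
    have h1 : ρ (f.eval c) ∈ x := by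
      have := sub_mem hf (hdvd f)
      simpa using this
    exact Ideal.IsPrime.ne_top inferInstance
      (Ideal.eq_top_of_isUnit_mem x h1 ((IsUnit.mk0 _ h0).map ρ))
  let p := minpoly k (Ideal.Quotient.mk n a)
  have hpN : ev (p.map (algebraMap k K)) ∈ N := by
    rw [hevmap]
    apply Ideal.mem_map_of_mem
    rw [← Ideal.Quotient.eq_zero_iff_mem]
    exact (Polynomial.aeval_algHom_apply (Ideal.Quotient.mkₐ k n) a p).symm.trans
      (minpoly.aeval k _)
  have hpsep : p.Separable := (minpoly.irreducible hαi).separable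
  have hpc : (p.map (algebraMap k K)).eval c = 0 := heval _ (hNx hpN)
  obtain ⟨q, hq⟩ := Polynomial.dvd_iff_isRoot.mpr hpc
  have hqc : q.eval c ≠ 0 := by
    have hsep : (p.map (algebraMap k K)).Separable := hpsep.map
    have h1 := hsep.eval₂_derivative_ne_zero (RingHom.id K) (x := c) (by simpa using hpc)
    rw [hq] at h1
    simpa using h1
  refine ⟨ev q, fun h => hqc (heval q h), fun b hb => ?_⟩
  obtain ⟨f, hf⟩ := claim1 b
  have hfx : ev f ∈ x := by
    have := sub_mem hb (hNx hf)
    simpa using this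
  obtain ⟨r, hr⟩ := Polynomial.dvd_iff_isRoot.mpr (heval f hfx)
  have h1 : ev q * ev f ∈ N := by
    have : ev q * ev f = ev r * ev (p.map (algebraMap k K)) := by
      rw [← map_mul, ← map_mul, hr, hq]
      congr 1
      ring
    rw [this]
    exact N.mul_mem_left _ hpN
  have : ev q * b = ev q * (b - ev f) + ev q * ev f := by ring
  rw [this]
  exact add_mem (N.mul_mem_left _ hf) h1

end Helpers

section Psi

variable {A : Type u} [CommRing A] {B : Type*} [CommRing B] [Algebra A B]
variable (M : Type v) [AddCommGroup M] [Module A M]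

/-- The comparison map `B ⊗ (n ⊗ M) → x ⊗ (B ⊗ M)`. -/
noncomputable def psiAux (n : Ideal A) (x : Ideal B) (h : ∀ a ∈ n, algebraMap A B a ∈ x) :
    (n ⊗[A] M) →ₗ[A] (x ⊗[B] (B ⊗[A] M)) :=
  TensorProduct.lift (LinearMap.mk₂ A (fun (a : n) (y : M) =>
      (⟨algebraMap A B a, h _ a.2⟩ : x) ⊗ₜ[B] ((1 : B) ⊗ₜ[A] y))
    (fun a a' y => by
      rw [← TensorProduct.add_tmul]; congr 1; ext; simp)
    (fun r a y => by
      rw [TensorProduct.smul_tmul']; congr 1; ext; simp [Algebra.smul_def])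
    (fun a y y' => by
      rw [← TensorProduct.tmul_add, ← TensorProduct.tmul_add])
    (fun r a y => by
      rw [TensorProduct.tmul_smul, ← algebraMap_smul B r, TensorProduct.tmul_smul,
        algebraMap_smul]))

noncomputable def psi (n : Ideal A) (x : Ideal B) (h : ∀ a ∈ n, algebraMap A B a ∈ x) :
    (B ⊗[A] (n ⊗[A] M)) →ₗ[B] (x ⊗[B] (B ⊗[A] M)) :=
  (psiAux M n x h).liftBaseChange B

theorem psi_tmul (n : Ideal A) (x : Ideal B) (h : ∀ a ∈ n, algebraMap A B a ∈ x)
    (b : B) (a : n) (y : M) : psi M n x h (b ⊗ₜ (a ⊗ₜ y)) =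
      b • ((⟨algebraMap A B a, h _ a.2⟩ : x) ⊗ₜ[B] ((1 : B) ⊗ₜ[A] y)) := by
  simp [psi, psiAux]

theorem torMul_psi (n : Ideal A) (x : Ideal B) (h : ∀ a ∈ n, algebraMap A B a ∈ x)
    (t : B ⊗[A] (n ⊗[A] M)) :
    torMul B (B ⊗[A] M) x (psi M n x h t) = (torMul A M n).lTensor B t := by
  induction t with
  | zero => simp
  | add s t hs ht => rw [map_add, map_add, map_add, hs, ht]
  | tmul b z =>
    induction z with
    | zero => simp
    | add s t hs ht => rw [TensorProduct.tmul_add, map_add, map_add, map_add, hs, ht]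
    | tmul a y =>
      rw [psi_tmul, map_smul, torMul_tmul', LinearMap.lTensor_tmul, torMul_tmul',
        TensorProduct.tmul_smul, algebraMap_smul, ← TensorProduct.tmul_smul,
        TensorProduct.smul_tmul']
      simp

theorem exists_psi (n : Ideal A) (x : Ideal B) (h : ∀ a ∈ n, algebraMap A B a ∈ x)
    (s : B) (hs : ∀ b ∈ x, s * b ∈ n.map (algebraMap A B)) (t : x ⊗[B] (B ⊗[A] M)) :
    ∃ t', psi M n x h t' = s • t := by
  have hle : n.map (algebraMap A B) ≤ x := Ideal.map_le_iff_le_comap.mpr h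
  have key : ∀ (y : M) (b : B) (hb : b ∈ n.map (algebraMap A B)), ∃ t',
      psi M n x h t' = (⟨b, hle hb⟩ : x) ⊗ₜ[B] ((1 : B) ⊗ₜ[A] y) := by
    intro y b hb
    induction hb using Submodule.span_induction with
    | mem b hb =>
      obtain ⟨a, ha, rfl⟩ := hb
      exact ⟨1 ⊗ₜ (⟨a, ha⟩ ⊗ₜ y), by rw [psi_tmul, one_smul]⟩
    | zero => exact ⟨0, by rw [map_zero]; exact (TensorProduct.zero_tmul _ _).symm⟩
    | add b b' hb hb' h1 h2 =>
      obtain ⟨u, hu⟩ := h1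
      obtain ⟨u', hu'⟩ := h2
      exact ⟨u + u', by rw [map_add, hu, hu', ← TensorProduct.add_tmul]; rfl⟩
    | smul r b hb h1 =>
      obtain ⟨u, hu⟩ := h1
      exact ⟨r • u, by rw [map_smul, hu, TensorProduct.smul_tmul']; rfl⟩
  induction t with
  | zero => exact ⟨0, by simp⟩
  | add t t' h1 h2 =>
    obtain ⟨u, hu⟩ := h1
    obtain ⟨u', hu'⟩ := h2
    exact ⟨u + u', by rw [map_add, hu, hu', smul_add]⟩
  | tmul b z =>
    induction z with
    | zero => exact ⟨0, by simp⟩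
    | add t t' h1 h2 =>
      obtain ⟨u, hu⟩ := h1
      obtain ⟨u', hu'⟩ := h2
      exact ⟨u + u', by rw [map_add, hu, hu', TensorProduct.tmul_add, smul_add]⟩
    | tmul r y =>
      obtain ⟨u, hu⟩ := key y (s * b) (hs _ b.2)
      refine ⟨r • u, ?_⟩
      rw [map_smul, hu, show r ⊗ₜ[A] y = r • ((1 : B) ⊗ₜ[A] y) by
        rw [TensorProduct.smul_tmul', smul_eq_mul, mul_one], TensorProduct.tmul_smul,
        smul_comm s r, TensorProduct.smul_tmul' s]
      rfl

theorem exists_ker_lift [Module.Flat A B] {P : Type*} [AddCommMonoid P] [Module A P]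
    (f : P →ₗ[A] M) (u : B ⊗[A] P) (hu0 : f.lTensor B u = 0) :
    ∃ w, (LinearMap.ker f).subtype.lTensor B w = u := by
  let _ : AddCommGroup P := Module.addCommMonoidToAddCommGroup A
  have hex : Function.Exact ((LinearMap.ker f).subtype) f :=
    LinearMap.exact_subtype_ker_map _
  exact ((Module.Flat.lTensor_exact B hex) u).mp hu0

end Psi

/-- **Base change of the descent condition to the algebraic closure**
(modules): condition (2) of the descent theorem over `k` implies condition
(3) over the algebraic closure `K`. -/
theorem generation_condition_implies_trivial_action_after_base_change
    (k : Type*) [Field k] [CharZero k]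
    (K : Type*) [Field K] [Algebra k K] [IsAlgClosed K] [Algebra.IsAlgebraic k K]
    (A : Type u) [CommRing A] [Algebra k A] [Algebra.FiniteType k A]
    (G : Type w) [Group G] [Finite G] [MulSemiringAction G A] [SMulCommClass G k A]
    (M : Type v) [AddCommGroup M] [Module A M] [Module.Finite A M]
    [DistribMulAction G M]
    (hGM : ∀ (g : G) (a : A) (x : M), g • (a • x) = (g • a) • (g • x))
    -- for every maximal ideal `n ⊆ A`, the fiber `M ⊗[A] A/n` and
    -- `Tor₁ᴬ(M, A/n)` are generated by `G_n`-fixed elements: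
    (hyp : ∀ n : Ideal A, n.IsMaximal →
      (Submodule.span A {y : M | ∀ g : G, (∀ a : A, g • a ∈ n ↔ a ∈ n) →
          g • y - y ∈ n • (⊤ : Submodule A M)} = ⊤) ∧
      (∀ t : n ⊗[A] M, torMul A M n t = 0 →
        t ∈ Submodule.span A {t' : n ⊗[A] M | torMul A M n t' = 0 ∧
          ∀ (g : G) (hg : ∀ a : A, g • a ∈ n ↔ a ∈ n),
            torSmul (MulSemiringAction.toRingHom G A g)
              (DistribMulAction.toAddMonoidHom M g)
              (fun a x => hGM g a x) n (fun a ha => (hg a).mpr ha) t' = t'})) :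
    ∀ x : Ideal (A ⊗[k] K), x.IsMaximal →
      -- `G_x` fixes every element of the fiber `M_K ⊗[A_K] A_K/x` ...
      (∀ (y : (A ⊗[k] K) ⊗[A] M) (g : G),
        (∀ b : A ⊗[k] K, g • b ∈ x ↔ b ∈ x) →
        bcModSmul k K A G M hGM g y - y ∈
          x • (⊤ : Submodule (A ⊗[k] K) ((A ⊗[k] K) ⊗[A] M))) ∧
      -- ... and every element of `Tor₁^{A_K}(M_K, A_K/x)`
      (∀ t : x ⊗[A ⊗[k] K] ((A ⊗[k] K) ⊗[A] M),
        torMul (A ⊗[k] K) ((A ⊗[k] K) ⊗[A] M) x t = 0 →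
        ∀ (g : G) (hg : ∀ b : A ⊗[k] K, g • b ∈ x ↔ b ∈ x),
          torSmul (MulSemiringAction.toRingHom G (A ⊗[k] K) g)
            (bcModSmul k K A G M hGM g)
            (fun b t => bcModSmul_smul k K A G M hGM g b t) x
            (fun b hb => (hg b).mpr hb) t = t) := by
  intro x hxm
  obtain ⟨n, hn⟩ : ∃ n : Ideal A, n = x.comap (algebraMap A (A ⊗[k] K)) := ⟨_, rfl⟩
  have hint : Algebra.IsIntegral A (A ⊗[k] K) := inferInstance
  have hnm : n.IsMaximal := hn ▸ Ideal.isMaximal_comap_of_isIntegral_of_isMaximal x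
  have hfin : Module.Finite k (A ⧸ n) := by
    letI : Field (A ⧸ n) := Ideal.Quotient.field n
    exact finite_of_finite_type_of_isJacobsonRing k (A ⧸ n)
  have hx : ∀ b : A ⊗[k] K, ∃ c : K, b - 1 ⊗ₜ c ∈ x := by
    refine exists_scalar_mod k K A x fun a => ?_
    obtain ⟨p, hp, hpa⟩ := Algebra.IsIntegral.isIntegral (R := k) (Ideal.Quotient.mk n a)
    refine ⟨p, hp, ?_⟩
    rw [← hn, ← Ideal.Quotient.eq_zero_iff_mem]
    exact (Polynomial.aeval_algHom_apply (Ideal.Quotient.mkₐ k n) a p).symm.trans hpa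
  have hgB : ∀ (g : G), (∀ b : A ⊗[k] K, g • b ∈ x ↔ b ∈ x) →
      ∀ b : A ⊗[k] K, g • b - b ∈ x := by
    intro g hg b
    obtain ⟨c, hc⟩ := hx b
    have h1 := (hg _).mpr hc
    rw [smul_sub, baseChange_smul_tmul, smul_one] at h1
    simpa using sub_mem h1 hc
  have hgA : ∀ (g : G), (∀ b : A ⊗[k] K, g • b ∈ x ↔ b ∈ x) →
      ∀ a : A, g • a - a ∈ n := by
    intro g hg a
    rw [hn, Ideal.mem_comap, map_sub, ← baseChange_smul_algebraMap]
    exact hgB g hg _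
  have hgn : ∀ (g : G), (∀ b : A ⊗[k] K, g • b ∈ x ↔ b ∈ x) →
      ∀ a : A, g • a ∈ n ↔ a ∈ n := by
    intro g hg a
    rw [hn, Ideal.mem_comap, Ideal.mem_comap, ← baseChange_smul_algebraMap]
    exact hg _
  obtain ⟨hyp1, hyp2⟩ := hyp n hnm
  constructor
  · intro y g hg
    have hM : ∀ y : M, g • y - y ∈ n • (⊤ : Submodule A M) := by
      intro y
      have hy : y ∈ Submodule.span A {y : M | ∀ g : G, (∀ a : A, g • a ∈ n ↔ a ∈ n) →
          g • y - y ∈ n • (⊤ : Submodule A M)} := by rw [hyp1]; trivial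
      induction hy using Submodule.span_induction with
      | mem y hy => exact hy g (hgn g hg)
      | zero => simp
      | add y z _ _ h1 h2 =>
        rw [smul_add, add_sub_add_comm]
        exact add_mem h1 h2
      | smul a y _ h1 =>
        have : g • (a • y) - a • y = (g • a - a) • (g • y) + a • (g • y - y) := by
          rw [hGM, sub_smul, smul_sub]; abel
        rw [this]
        exact add_mem (Submodule.smul_mem_smul (hgA g hg a) trivial)
          (Submodule.smul_mem _ _ h1)
    have hM' : ∀ z ∈ n • (⊤ : Submodule A M), (1 : A ⊗[k] K) ⊗ₜ[A] z ∈
        x • (⊤ : Submodule (A ⊗[k] K) ((A ⊗[k] K) ⊗[A] M)) := by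
      intro z hz
      induction hz using Submodule.smul_induction_on' with
      | smul a ha z _ =>
        rw [TensorProduct.tmul_smul, ← algebraMap_smul (A ⊗[k] K) a]
        rw [hn] at ha
        exact Submodule.smul_mem_smul ha trivial
      | add z _ w _ h1 h2 =>
        rw [TensorProduct.tmul_add]
        exact add_mem h1 h2
    induction y with
    | zero => simp
    | add y z h1 h2 =>
      rw [map_add, add_sub_add_comm]
      exact add_mem h1 h2
    | tmul b y =>
      have e : ∀ (b : A ⊗[k] K) (z : M), b ⊗ₜ[A] z = b • ((1 : A ⊗[k] K) ⊗ₜ[A] z) := by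
        intro b z
        rw [TensorProduct.smul_tmul', smul_eq_mul, mul_one]
      have : bcModSmul k K A G M hGM g (b ⊗ₜ y) - b ⊗ₜ y =
          (g • b - b) • ((1 : A ⊗[k] K) ⊗ₜ[A] (g • y)) +
          b • ((1 : A ⊗[k] K) ⊗ₜ[A] (g • y - y)) := by
        rw [bcModSmul_tmul, ← e, ← e, TensorProduct.sub_tmul, TensorProduct.tmul_sub]; abel
      rw [this]
      exact add_mem (Submodule.smul_mem_smul (hgB g hg b) trivial)
        (Submodule.smul_mem _ _ (hM' _ (hM y)))
  · intro t ht g hg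
    have hT : ∃ T : (n ⊗[A] M) →+ (n ⊗[A] M),
        (∀ t ∈ {t' : n ⊗[A] M | torMul A M n t' = 0 ∧
          ∀ (g : G) (hg : ∀ a : A, g • a ∈ n ↔ a ∈ n),
            torSmul (MulSemiringAction.toRingHom G A g)
              (DistribMulAction.toAddMonoidHom M g)
              (fun a x => hGM g a x) n (fun a ha => (hg a).mpr ha) t' = t'}, T t = t) ∧
        (∀ (a : A) (t : n ⊗[A] M), T (a • t) = (g • a) • T t) ∧
        (∀ (a : n) (y : M), T (a ⊗ₜ y) =
          (⟨g • (a : A), (hgn g hg a).mpr a.2⟩ : n) ⊗ₜ[A] (g • y)) :=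
      ⟨torSmul (MulSemiringAction.toRingHom G A g)
              (DistribMulAction.toAddMonoidHom M g)
              (fun a x => hGM g a x) n (fun a ha => (hgn g hg a).mpr ha), fun t ht => ht.2 g (hgn g hg), fun a t => torSmul_smul' _ _ _ _ _ a t,
        fun a y => torSmul_tmul' _ _ _ _ _ a y⟩
    obtain ⟨T, hTfix, hTsmul, hTtmul⟩ := hT
    have hT' : ∃ T' : (x ⊗[A ⊗[k] K] ((A ⊗[k] K) ⊗[A] M)) →+
          (x ⊗[A ⊗[k] K] ((A ⊗[k] K) ⊗[A] M)),
        T' = torSmul (MulSemiringAction.toRingHom G (A ⊗[k] K) g)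
            (bcModSmul k K A G M hGM g)
            (fun b t => bcModSmul_smul k K A G M hGM g b t) x
            (fun b hb => (hg b).mpr hb) ∧
        (∀ (b : A ⊗[k] K) (t : x ⊗[A ⊗[k] K] ((A ⊗[k] K) ⊗[A] M)),
          T' (b • t) = (g • b) • T' t) ∧
        (∀ (b : x) (y : (A ⊗[k] K) ⊗[A] M), T' (b ⊗ₜ y) =
          (⟨g • (b : A ⊗[k] K), (hg b).mpr b.2⟩ : x) ⊗ₜ[A ⊗[k] K]
            (bcModSmul k K A G M hGM g y)) :=
      ⟨_, rfl, fun a t => torSmul_smul' _ _ _ _ _ a t,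
        fun a y => torSmul_tmul' _ _ _ _ _ a y⟩
    obtain ⟨T', hT'eq, hT'smul, hT'tmul⟩ := hT'
    suffices hgoal : T' t = t by rw [hT'eq] at hgoal; exact hgoal
    have hL : ∀ t : n ⊗[A] M, torMul A M n t = 0 →
        T t = t := by
      intro t ht
      have h := hyp2 t ht
      clear ht
      have h' : torMul A M n t = 0 ∧ T t = t := by
        induction h using Submodule.span_induction with
        | mem t h => exact ⟨h.1, hTfix t h⟩
        | zero => exact ⟨map_zero _, map_zero _⟩
        | add t u _ _ h1 h2 =>
          exact ⟨by rw [map_add, h1.1, h2.1, add_zero], by rw [map_add, h1.2, h2.2]⟩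
        | smul a t _ h1 =>
          refine ⟨by rw [map_smul, h1.1, smul_zero], ?_⟩
          rw [hTsmul, h1.2]
          exact smul_eq_smul_of_torMul n _ _ (hgA g hg a) t h1.1
      exact h'.2
    obtain ⟨s, hsx, hs⟩ := exists_local_generator k K A x n hn hx
    have hnx : ∀ a ∈ n, algebraMap A (A ⊗[k] K) a ∈ x := fun a ha => by
      rw [hn] at ha; exact ha
    obtain ⟨u, hu⟩ := exists_psi M n x hnx s hs t
    have hu0 : (torMul A M n).lTensor (A ⊗[k] K) u = 0 := by
      rw [← torMul_psi M n x hnx, hu, map_smul, ht, smul_zero]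
    obtain ⟨w, hw⟩ := exists_ker_lift M (torMul A M n) u hu0
    have hpsi : ∀ z : n ⊗[A] M,
        T' (psi M n x hnx (1 ⊗ₜ z)) =
        psi M n x hnx (1 ⊗ₜ T z) := by
      intro z
      induction z with
      | zero => simp only [TensorProduct.tmul_zero, map_zero]
      | add z z' h1 h2 => simp only [TensorProduct.tmul_add, map_add, h1, h2]
      | tmul a y =>
        rw [hTtmul, psi_tmul, psi_tmul, one_smul, one_smul, hT'tmul,
          bcModSmul_tmul, smul_one]
        simp only [baseChange_smul_algebraMap]
    have hfix : ∀ w : (A ⊗[k] K) ⊗[A] (LinearMap.ker (torMul A M n)),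
        T' (psi M n x hnx
              ((LinearMap.ker (torMul A M n)).subtype.lTensor (A ⊗[k] K) w)) =
          psi M n x hnx ((LinearMap.ker (torMul A M n)).subtype.lTensor (A ⊗[k] K) w) := by
      intro w
      induction w with
      | zero => simp only [map_zero]
      | add w w' h1 h2 => simp only [map_add, h1, h2]
      | tmul b l =>
        have hl : torMul A M n l = 0 := l.2
        have e : b ⊗ₜ[A] (l : n ⊗[A] M) = b • ((1 : A ⊗[k] K) ⊗ₜ[A] (l : n ⊗[A] M)) := by
          rw [TensorProduct.smul_tmul', smul_eq_mul, mul_one]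
        rw [LinearMap.lTensor_tmul, Submodule.subtype_apply, e, map_smul, hT'smul, hpsi,
          hL _ hl]
        refine smul_eq_smul_of_torMul x _ _ (hgB g hg b) _ ?_
        rw [torMul_psi, LinearMap.lTensor_tmul, hl, TensorProduct.tmul_zero]
    have hst := hfix w
    rw [hw, hu] at hst
    obtain ⟨s', hs'⟩ : ∃ s', 1 - s' * s ∈ x := by
      obtain ⟨s', i, hi, h⟩ := hxm.exists_inv hsx
      exact ⟨s', by rw [← h]; simpa using hi⟩
    have htt : t = s' • (s • t) := by
      rw [smul_smul]
      exact (one_smul (A ⊗[k] K) t).symm.trans (smul_eq_smul_of_torMul x _ _ hs' t ht)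
    rw [htt, hT'smul, hst]
    refine smul_eq_smul_of_torMul x _ _ (hgB g hg s') _ ?_
    rw [map_smul, ht, smul_zero]
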